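/- arXiv:2210.06727 — 2 statements merged into one kernel-verified Lean document; each statement's English description precedes it below -/
import Mathlib

section
/- For every integer n ≥ 1 and every ξ ∈ ℝ^{n+1} with |ξ| < 1, ∫_{S^n} ( √(1 − |ξ|²) / (1 − ξ·ω) )^n dω = |S^n|, where |S^n| = 2π^{(n+1)/2}/Γ((n+1)/2). -/
open MeasureTheory Real
open scoped RealInnerProductSpace

noncomputable section

/-- The unit sphere `S^n ⊂ ℝ^{n+1}`. -/
abbrev Sph (n : ℕ) := Metric.sphere (0 : EuclideanSpace ℝ (Fin (n + 1))) 1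

/-- The surface measure `σ` on the unit sphere `S^n ⊂ ℝ^{n+1}`. -/
def sphMeasure (n : ℕ) : Measure (Sph n) :=
  (volume : Measure (EuclideanSpace ℝ (Fin (n + 1)))).toSphere

/-- The Lorentz boost acting on the light cone, parametrised by its spatial part. -/
def boost {E : Type*} [NormedAddCommGroup E] [InnerProductSpace ℝ E] (γ : ℝ) (ξ x : E) : E :=
  x + (γ ^ 2 / (1 + γ) * ⟪ξ, x⟫ - γ * ‖x‖) • ξ

section boost
variable {E : Type*} [NormedAddCommGroup E] [InnerProductSpace ℝ E]

lemma sub_inner_pos {ξ x : E} (hξ : ‖ξ‖ < 1) (hx : x ≠ 0) : 0 < ‖x‖ - ⟪ξ, x⟫ := by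
  have h1 := real_inner_le_norm ξ x
  have h2 : 0 < ‖x‖ := norm_pos_iff.2 hx
  nlinarith

lemma sub_inner_nonneg {ξ x : E} (hξ : ‖ξ‖ < 1) : 0 ≤ ‖x‖ - ⟪ξ, x⟫ := by
  have h1 := real_inner_le_norm ξ x
  have h2 : 0 ≤ ‖x‖ := norm_nonneg x
  nlinarith

lemma inner_boost {γ : ℝ} {ξ : E} (hγ : 0 < γ) (h : γ ^ 2 * (1 - ‖ξ‖ ^ 2) = 1) (x : E) :
    ⟪ξ, boost γ ξ x⟫ = γ * ⟪ξ, x⟫ - γ * ‖x‖ * ‖ξ‖ ^ 2 := by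
  have h1 : (1 + γ) ≠ 0 := by positivity
  simp only [boost, inner_add_right, inner_smul_right, real_inner_self_eq_norm_sq]
  have h2 : γ ^ 2 * ‖ξ‖ ^ 2 = (γ - 1) * (1 + γ) := by linarith
  have h3 : γ ^ 2 / (1 + γ) * ‖ξ‖ ^ 2 = γ - 1 := by
    rw [div_mul_eq_mul_div, h2]; field_simp
  linear_combination ⟪ξ, x⟫ * h3

lemma norm_boost {γ : ℝ} {ξ : E} (hξ : ‖ξ‖ < 1) (hγ : 0 < γ)
    (h : γ ^ 2 * (1 - ‖ξ‖ ^ 2) = 1) (x : E) :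
    ‖boost γ ξ x‖ = γ * (‖x‖ - ⟪ξ, x⟫) := by
  have h1 : (1 + γ) ≠ 0 := by positivity
  have h2 : γ ^ 2 * ‖ξ‖ ^ 2 = (γ - 1) * (1 + γ) := by linarith
  have h3 : γ ^ 2 / (1 + γ) * ‖ξ‖ ^ 2 = γ - 1 := by
    rw [div_mul_eq_mul_div, h2]; field_simp
  have h4 : γ ^ 2 / (1 + γ) * (1 + γ) = γ ^ 2 := by field_simp
  have h0 := sub_inner_nonneg (x := x) hξ
  rw [← sq_eq_sq₀ (norm_nonneg _) (by positivity)]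
  rw [boost, norm_add_sq_real, inner_smul_right, norm_smul, mul_pow, Real.norm_eq_abs, sq_abs,
    real_inner_comm ξ x]
  generalize γ ^ 2 / (1 + γ) = a at *
  generalize ⟪ξ, x⟫ = s at *
  generalize ‖x‖ = r at *
  generalize ‖ξ‖ = v at *
  linear_combination (a * s ^ 2 - 2 * γ * s * r) * h3 + s ^ 2 * h4 - r ^ 2 * h

lemma boost_neg_boost {γ : ℝ} {ξ : E} (hξ : ‖ξ‖ < 1) (hγ : 0 < γ)
    (h : γ ^ 2 * (1 - ‖ξ‖ ^ 2) = 1) (x : E) :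
    boost γ (-ξ) (boost γ ξ x) = x := by
  have h1 : (1 + γ) ≠ 0 := by positivity
  rw [boost, norm_boost hξ hγ h, inner_neg_left, inner_boost hγ h, boost, smul_neg, ← neg_smul,
    add_assoc, ← add_smul]
  convert add_zero x
  rw [smul_eq_zero]
  left
  have h2 : γ ^ 2 * ‖ξ‖ ^ 2 = (γ - 1) * (1 + γ) := by linarith
  have h3 : γ ^ 2 / (1 + γ) * ‖ξ‖ ^ 2 = γ - 1 := by
    rw [div_mul_eq_mul_div, h2]; field_simp
  have h4 : γ ^ 2 / (1 + γ) * (1 + γ) = γ ^ 2 := by field_simp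
  generalize γ ^ 2 / (1 + γ) = a at *
  linear_combination (-γ * ‖x‖) * h3 + ⟪ξ, x⟫ * h4

lemma boost_ne_zero {γ : ℝ} {ξ : E} (hξ : ‖ξ‖ < 1) (hγ : 0 < γ)
    (h : γ ^ 2 * (1 - ‖ξ‖ ^ 2) = 1) {x : E} (hx : x ≠ 0) : boost γ ξ x ≠ 0 := by
  rw [← norm_pos_iff, norm_boost hξ hγ h]
  exact mul_pos hγ (sub_inner_pos hξ hx)

lemma boost_image {γ : ℝ} {ξ : E} (hξ : ‖ξ‖ < 1) (hγ : 0 < γ)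
    (h : γ ^ 2 * (1 - ‖ξ‖ ^ 2) = 1) : boost γ ξ '' {0}ᶜ = {0}ᶜ := by
  ext y
  constructor
  · rintro ⟨x, hx, rfl⟩
    exact boost_ne_zero hξ hγ h hx
  · intro hy
    have hξ' : ‖-ξ‖ < 1 := by rwa [norm_neg]
    have h' : γ ^ 2 * (1 - ‖-ξ‖ ^ 2) = 1 := by rwa [norm_neg]
    refine ⟨boost γ (-ξ) y, boost_ne_zero hξ' hγ h' hy, ?_⟩
    simpa using boost_neg_boost hξ' hγ h' y

/-- the derivative of the boost -/
def boostDeriv (γ : ℝ) (ξ x : E) : E →L[ℝ] E :=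
  ContinuousLinearMap.id ℝ E +
    ((γ ^ 2 / (1 + γ)) • innerSL ℝ ξ - (γ * ‖x‖⁻¹) • innerSL ℝ x).smulRight ξ

lemma hasFDerivAt_norm' {x : E} (hx : x ≠ 0) :
    HasFDerivAt (fun y : E => ‖y‖) (‖x‖⁻¹ • innerSL ℝ x) x := by
  have h0 : ‖x‖ ≠ 0 := norm_ne_zero_iff.2 hx
  have h1 := (hasStrictFDerivAt_norm_sq x).hasFDerivAt.sqrt (by positivity)
  simp only [Real.sqrt_sq (norm_nonneg _)] at h1
  convert h1 using 1
  ext y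
  simp
  field_simp

lemma hasFDerivAt_boost (γ : ℝ) (ξ : E) {x : E} (hx : x ≠ 0) :
    HasFDerivAt (boost γ ξ) (boostDeriv γ ξ x) x := by
  have h1 := hasFDerivAt_norm' hx
  have h2 := (innerSL ℝ ξ).hasFDerivAt (x := x)
  have h3 := (hasFDerivAt_id (𝕜 := ℝ) x).add
    (((h2.const_mul (γ ^ 2 / (1 + γ))).sub (h1.const_mul γ)).smul_const ξ)
  rw [boostDeriv, mul_smul]
  exact h3

lemma det_boostDeriv [FiniteDimensional ℝ E] {γ : ℝ} {ξ : E} (hγ : 0 < γ)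
    (h : γ ^ 2 * (1 - ‖ξ‖ ^ 2) = 1) {x : E} (hx : x ≠ 0) :
    (boostDeriv γ ξ x).det = γ * (‖x‖ - ⟪ξ, x⟫) / ‖x‖ := by
  have h0 : ‖x‖ ≠ 0 := norm_ne_zero_iff.2 hx
  have h1 : (1 + γ) ≠ 0 := by positivity
  have h2 : γ ^ 2 * ‖ξ‖ ^ 2 = (γ - 1) * (1 + γ) := by linarith
  have h3 : γ ^ 2 / (1 + γ) * ‖ξ‖ ^ 2 = γ - 1 := by
    rw [div_mul_eq_mul_div, h2]; field_simp
  set f : E →L[ℝ] ℝ := (γ ^ 2 / (1 + γ)) • innerSL ℝ ξ - (γ * ‖x‖⁻¹) • innerSL ℝ x with hf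
  have h4 : ((boostDeriv γ ξ x : E →L[ℝ] E) : E →ₗ[ℝ] E)
      = LinearMap.transvection (f : E →ₗ[ℝ] ℝ) ξ := by
    ext y
    simp [boostDeriv, LinearMap.transvection, hf]
  rw [ContinuousLinearMap.det, h4, LinearMap.transvection.det]
  simp only [hf, ContinuousLinearMap.coe_coe, _root_.sub_apply,
    _root_.smul_apply, innerSL_apply_apply, real_inner_self_eq_norm_sq, smul_eq_mul, h3,
    real_inner_comm ξ x]
  field_simp
  ring

end boost

section polar
variable {E : Type*} [NormedAddCommGroup E] [InnerProductSpace ℝ E] [FiniteDimensional ℝ E]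
  [MeasurableSpace E] [BorelSpace E]

open scoped ENNReal

lemma lintegral_boost {γ : ℝ} {ξ : E} (hξ : ‖ξ‖ < 1) (hγ : 0 < γ)
    (h : γ ^ 2 * (1 - ‖ξ‖ ^ 2) = 1) (μ : Measure E) [μ.IsAddHaarMeasure] :
    ∫⁻ x in {0}ᶜ, ENNReal.ofReal (exp (-‖x‖) / ‖x‖) ∂μ =
      ∫⁻ x in {0}ᶜ, ENNReal.ofReal (exp (-(γ * (‖x‖ - ⟪ξ, x⟫))) / ‖x‖) ∂μ := by
  have hs : MeasurableSet ({0}ᶜ : Set E) := (measurableSet_singleton 0).compl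
  conv_lhs => rw [← boost_image hξ hγ h]
  rw [lintegral_image_eq_lintegral_abs_det_fderiv_mul μ hs
    (fun x hx => (hasFDerivAt_boost γ ξ hx).hasFDerivWithinAt)
    (fun x _ y _ hxy => by
      rw [← boost_neg_boost hξ hγ h x, hxy, boost_neg_boost hξ hγ h y])]
  refine setLIntegral_congr_fun hs fun x hx => ?_
  have hx' : x ≠ 0 := hx
  have hp := mul_pos hγ (sub_inner_pos hξ hx')
  have hn : 0 < ‖x‖ := norm_pos_iff.2 hx'
  rw [det_boostDeriv hγ h hx', norm_boost hξ hγ h, ← ENNReal.ofReal_mul (abs_nonneg _),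
    abs_of_nonneg (by positivity)]
  congr 1
  have hq := (sub_inner_pos hξ hx').ne'
  field_simp

lemma lintegral_polar (μ : Measure E) [μ.IsAddHaarMeasure] {f : E → ℝ≥0∞} (hf : Measurable f) :
    ∫⁻ x in {0}ᶜ, f x ∂μ = ∫⁻ ω : Metric.sphere (0 : E) 1, (∫⁻ r in Set.Ioi (0 : ℝ),
      ENNReal.ofReal (r ^ (Module.finrank ℝ E - 1)) * f (r • (ω : E))) ∂μ.toSphere := by
  have hs : MeasurableSet ({0}ᶜ : Set E) := (measurableSet_singleton 0).compl
  have hg : Measurable (fun p : Metric.sphere (0 : E) 1 × Set.Ioi (0 : ℝ) =>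
      f ((p.2 : ℝ) • (p.1 : E))) := by
    apply hf.comp
    fun_prop
  rw [← lintegral_subtype_comap hs]
  have key := (μ.measurePreserving_homeomorphUnitSphereProd).lintegral_comp hg
  have e : ∀ x : ({0}ᶜ : Set E), f ((((homeomorphUnitSphereProd E) x).2 : ℝ) •
      (((homeomorphUnitSphereProd E) x).1 : E)) = f x := by
    intro x
    congr 1
    have := (homeomorphUnitSphereProd E).symm_apply_apply x
    conv_rhs => rw [← this, homeomorphUnitSphereProd_symm_apply_coe]
  simp only [e] at key
  rw [key, lintegral_prod _ hg.aemeasurable]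
  refine lintegral_congr fun ω => ?_
  have hm : Measurable (fun r : Set.Ioi (0 : ℝ) =>
      ENNReal.ofReal ((r : ℝ) ^ (Module.finrank ℝ E - 1))) := by fun_prop
  have hm2 : Measurable (fun r : Set.Ioi (0 : ℝ) => f ((r : ℝ) • (ω : E))) :=
    hg.comp measurable_prodMk_left
  rw [Measure.volumeIoiPow, lintegral_withDensity_eq_lintegral_mul _ hm hm2, ← lintegral_subtype_comap measurableSet_Ioi]
  rfl

end polar

open scoped ENNReal

lemma lintegral_radial (n : ℕ) (hn : 1 ≤ n) {c : ℝ} (hc : 0 < c) :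
    ∫⁻ r in Set.Ioi (0 : ℝ), ENNReal.ofReal (r ^ n) * ENNReal.ofReal (exp (-(c * r)) / r) =
      ENNReal.ofReal ((1 / c) ^ n) * ENNReal.ofReal (Gamma n) := by
  have hn' : (0 : ℝ) < n := by exact_mod_cast hn
  have key := integral_rpow_mul_exp_neg_mul_Ioi hn' hc
  have hG := Gamma_pos_of_pos hn'
  have hint : IntegrableOn (fun x : ℝ ↦ x ^ ((n : ℝ) - 1) * rexp (-(c * x))) (Set.Ioi 0) :=
    .of_integral_ne_zero (by rw [key]; positivity)
  rw [← ENNReal.ofReal_mul (by positivity), ← rpow_natCast, ← key,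
    ofReal_integral_eq_lintegral_ofReal hint]
  · refine setLIntegral_congr_fun measurableSet_Ioi fun r hr => ?_
    have hr' : 0 < r := hr
    rw [← ENNReal.ofReal_mul (by positivity), rpow_sub_one hr'.ne', rpow_natCast]
    congr 1
    field_simp
  · filter_upwards [ae_restrict_mem measurableSet_Ioi] with r hr
    have hr' : 0 < r := hr
    simp only [Pi.zero_apply]
    positivity

lemma polar_exp (n : ℕ) (hn : 1 ≤ n) {γ : ℝ} (hγ : 0 < γ)
    (ξ : EuclideanSpace ℝ (Fin (n + 1))) (hξ : ‖ξ‖ < 1) :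
    ∫⁻ x in {0}ᶜ, ENNReal.ofReal (exp (-(γ * (‖x‖ - ⟪ξ, x⟫))) / ‖x‖) =
      (∫⁻ ω : Sph n, ENNReal.ofReal
        ((1 / (γ * (1 - ⟪ξ, (ω : EuclideanSpace ℝ (Fin (n + 1)))⟫))) ^ n) ∂(sphMeasure n)) *
        ENNReal.ofReal (Gamma n) := by
  rw [lintegral_polar _ (by fun_prop), ← lintegral_mul_const' _ _ ENNReal.ofReal_ne_top]
  refine lintegral_congr fun ω => ?_
  have hω : ‖(ω : EuclideanSpace ℝ (Fin (n + 1)))‖ = 1 := by simp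
  have hω0 : (ω : EuclideanSpace ℝ (Fin (n + 1))) ≠ 0 := by
    rw [← norm_ne_zero_iff, hω]; exact one_ne_zero
  have hp := sub_inner_pos hξ hω0
  rw [hω] at hp
  rw [← lintegral_radial n hn (mul_pos hγ hp)]
  refine setLIntegral_congr_fun measurableSet_Ioi fun r hr => ?_
  have hr' : 0 < r := hr
  simp only [finrank_euclideanSpace_fin, Nat.add_sub_cancel, norm_smul, hω, inner_smul_right,
    Real.norm_eq_abs, abs_of_pos hr', mul_one]
  congr 5
  ring

lemma sphMeasure_univ (n : ℕ) : sphMeasure n Set.univ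
    = ENNReal.ofReal (2 * π ^ (((n : ℝ) + 1) / 2) / Real.Gamma (((n : ℝ) + 1) / 2)) := by
  have h1 : ((n : ℝ) + 1) / 2 ≠ 0 := by positivity
  have h2 : 0 < Real.Gamma (((n : ℝ) + 1) / 2) := Gamma_pos_of_pos (by positivity)
  rw [sphMeasure, Measure.toSphere_apply_univ, EuclideanSpace.volume_ball]
  simp only [finrank_euclideanSpace_fin, ENNReal.ofReal_one, one_pow, one_mul, Fintype.card_fin]
  rw [← ENNReal.ofReal_natCast, ← ENNReal.ofReal_mul (by positivity)]
  congr 1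
  push_cast
  rw [Real.Gamma_add_one h1, Real.sqrt_eq_rpow, ← rpow_natCast, ← rpow_mul pi_pos.le]
  have : (1 / 2 : ℝ) * ((n + 1 : ℕ) : ℝ) = ((n : ℝ) + 1) / 2 := by push_cast; ring
  rw [this]
  field_simp

lemma lintegral_jacobian (n : ℕ) (hn : 1 ≤ n)
    (ξ : EuclideanSpace ℝ (Fin (n + 1))) (hξ : ‖ξ‖ < 1) :
    ∫⁻ ω : Sph n, ENNReal.ofReal
        ((Real.sqrt (1 - ‖ξ‖ ^ 2) / (1 - ⟪ξ, (ω : EuclideanSpace ℝ (Fin (n + 1)))⟫)) ^ n)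
        ∂(sphMeasure n) = sphMeasure n Set.univ := by
  have hpos : 0 < 1 - ‖ξ‖ ^ 2 := by nlinarith [norm_nonneg ξ]
  have hs : 0 < √(1 - ‖ξ‖ ^ 2) := Real.sqrt_pos.2 hpos
  have hγ : 0 < (√(1 - ‖ξ‖ ^ 2))⁻¹ := inv_pos.2 hs
  have h : (√(1 - ‖ξ‖ ^ 2))⁻¹ ^ 2 * (1 - ‖ξ‖ ^ 2) = 1 := by
    rw [inv_pow, Real.sq_sqrt hpos.le, inv_mul_cancel₀ hpos.ne']
  have hG : 0 < Gamma n := Gamma_pos_of_pos (by exact_mod_cast hn)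
  have e := lintegral_boost hξ hγ h (volume : Measure (EuclideanSpace ℝ (Fin (n + 1))))
  have e0 := polar_exp n hn one_pos 0 (by simp)
  rw [polar_exp n hn hγ ξ hξ] at e
  simp only [inner_zero_left, sub_zero, one_mul] at e0
  rw [e0, ENNReal.mul_left_inj (by simpa using hG) ENNReal.ofReal_ne_top] at e
  simp only [div_one, one_pow, ENNReal.ofReal_one, lintegral_const, one_mul] at e
  rw [e]
  refine lintegral_congr fun ω => ?_
  congr 2
  rw [one_div, mul_inv, inv_inv, div_eq_mul_inv]

/-- for `|ξ| < 1`,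
`∫_{S^n} (√(1−|ξ|²)/(1−ξ·ω))^n dω = |S^n| = 2π^{(n+1)/2}/Γ((n+1)/2)`:
conformal Jacobians integrate to the total surface measure. -/
theorem integral_conformal_jacobian (n : ℕ) (hn : 1 ≤ n)
    (ξ : EuclideanSpace ℝ (Fin (n + 1))) (hξ : ‖ξ‖ < 1) :
    (∫ ω : Sph n,
        (Real.sqrt (1 - ‖ξ‖ ^ 2) / (1 - ⟪ξ, (ω : EuclideanSpace ℝ (Fin (n + 1)))⟫)) ^ n
        ∂(sphMeasure n)
      = 2 * π ^ (((n : ℝ) + 1) / 2) / Real.Gamma (((n : ℝ) + 1) / 2))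
    ∧ sphMeasure n Set.univ
        = ENNReal.ofReal (2 * π ^ (((n : ℝ) + 1) / 2) / Real.Gamma (((n : ℝ) + 1) / 2)) := by
  refine ⟨?_, sphMeasure_univ n⟩
  have hG : 0 < Real.Gamma (((n : ℝ) + 1) / 2) := Gamma_pos_of_pos (by positivity)
  rw [integral_eq_lintegral_of_nonneg_ae, lintegral_jacobian n hn ξ hξ, sphMeasure_univ,
    ENNReal.toReal_ofReal (by positivity)]
  · refine Filter.Eventually.of_forall fun ω => ?_
    have hp := sub_inner_nonneg (x := (ω : EuclideanSpace ℝ (Fin (n + 1)))) hξ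
    have hω : ‖(ω : EuclideanSpace ℝ (Fin (n + 1)))‖ = 1 := by simp
    rw [hω] at hp
    simp only [Pi.zero_apply]
    positivity
  · refine Measurable.aestronglyMeasurable ?_
    fun_prop
end
end

section
/- Let n ≥ 1 and let Y be a spherical harmonic of degree l ≥ 1 on S^n with ‖Y‖_{L²(S^n)} = 1. Then ∬_{S^n × S^n} |Y(ω) − Y(η)|²/|ω − η|^n dω dη = (4π^{n/2}/Γ(n/2))·(ψ(n/2 + l) − ψ(n/2)), where ψ is the digamma function and |ω − η| is the chordal (Euclidean) distance in ℝ^{n+1}. -/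
open MeasureTheory Real

noncomputable section

/-- The digamma function `ψ = Γ'/Γ`. -/
def digamma (x : ℝ) : ℝ := deriv Real.Gamma x / Real.Gamma x

/-- `Y : S^n → ℝ` is a spherical harmonic of degree `l`: the restriction to `S^n` of a
harmonic polynomial on `ℝ^{n+1}` which is homogeneous of degree `l`. -/
def IsSphericalHarmonic {n : ℕ} (l : ℕ) (Y : Sph n → ℝ) : Prop :=
  ∃ P : MvPolynomial (Fin (n + 1)) ℝ,
    P.IsHomogeneous l ∧
    (∑ i : Fin (n + 1), MvPolynomial.pderiv i (MvPolynomial.pderiv i P)) = 0 ∧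
    ∀ ω : Sph n, Y ω = MvPolynomial.eval (fun j => (ω : EuclideanSpace ℝ (Fin (n + 1))) j) P

abbrev EE (n : ℕ) := EuclideanSpace ℝ (Fin (n + 1))

/-- evaluation of a polynomial at a Euclidean vector -/
def pev {n : ℕ} (P : MvPolynomial (Fin (n + 1)) ℝ) (x : EE n) : ℝ :=
  MvPolynomial.eval (fun j => x j) P

lemma pev_continuous {n : ℕ} (P : MvPolynomial (Fin (n + 1)) ℝ) : Continuous (pev P) := by
  unfold pev
  exact (MvPolynomial.continuous_eval P).comp (by fun_prop)

lemma pev_smul {n d : ℕ} {P : MvPolynomial (Fin (n + 1)) ℝ} (hP : P.IsHomogeneous d) (r : ℝ)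
    (x : EE n) : pev P (r • x) = r ^ d * pev P x := by
  unfold pev
  rw [MvPolynomial.eval_eq', MvPolynomial.eval_eq', Finset.mul_sum]
  refine Finset.sum_congr rfl fun m hm => ?_
  have h := hP.degree_eq_sum_deg_support hm
  simp only [PiLp.smul_apply, smul_eq_mul, mul_pow, Finset.prod_mul_distrib, Finset.prod_pow_eq_pow_sum]
  have h2 : ∑ i, m i = d := by
    rw [h]
    symm
    apply Finset.sum_subset (Finset.subset_univ _)
    intro i _ hi
    simpa using hi
  rw [h2]; ring

lemma pev_hasFDerivAt {n : ℕ} (P : MvPolynomial (Fin (n + 1)) ℝ) (x : EE n) :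
    HasFDerivAt (pev P) (∑ i, pev (MvPolynomial.pderiv i P) x •
      (EuclideanSpace.proj (𝕜 := ℝ) i : EE n →L[ℝ] ℝ)) x := by
  induction P using MvPolynomial.induction_on with
  | C a =>
    have h := hasFDerivAt_const (𝕜 := ℝ) a x
    convert! h using 1
    · ext y; simp [pev]
    · simp [pev]
  | add p q hp hq =>
    have := hp.add hq
    convert! this using 1
    · ext y; simp [pev]
    · rw [← Finset.sum_add_distrib]
      simp [pev, add_smul]
  | mul_X p j hp =>
    have := hp.mul (EuclideanSpace.proj (𝕜 := ℝ) j : EE n →L[ℝ] ℝ).hasFDerivAt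
    convert! this using 1
    · ext y; simp [pev]
    · simp [pev, add_smul, Finset.sum_add_distrib, Finset.smul_sum, smul_smul, MvPolynomial.pderiv_X, Pi.single_apply]
      rw [Finset.sum_eq_single j]
      · simp
      · intro b _ hb
        simp [hb.symm]
      · simp

lemma gauss_integrable_pow (n k : ℕ) :
    Integrable (fun x : EE n => ‖x‖ ^ k * exp (-‖x‖ ^ 2)) := by
  have := (integrable_fun_norm_addHaar (E := EE n) volume (f := fun s : ℝ => s ^ k * exp (-s ^ 2))).2
  apply this
  have h := integrableOn_rpow_mul_exp_neg_mul_sq (b := 1) one_pos (s := (n + k : ℕ)) (by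
    have : (0 : ℝ) ≤ (n + k : ℕ) := by positivity
    linarith)
  refine h.congr_fun (fun s hs => ?_) measurableSet_Ioi
  simp only [rpow_natCast]
  simp [pow_add]
  ring

lemma gauss_integrable_homog {n d : ℕ} {P : MvPolynomial (Fin (n + 1)) ℝ} (hP : P.IsHomogeneous d) :
    Integrable (fun x : EE n => pev P x * exp (-‖x‖ ^ 2)) := by
  obtain ⟨C, hC⟩ := (isCompact_sphere (0 : EE n) 1).exists_bound_of_continuousOn
    (pev_continuous P).continuousOn
  refine ((gauss_integrable_pow n d).const_mul (max C ‖pev P (0 : EE n)‖)).mono' ?_ ?_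
  · exact ((pev_continuous P).mul (by fun_prop)).aestronglyMeasurable
  · have h0 : ∀ᵐ x : EE n, x ≠ 0 := by simp [ae_iff]
    filter_upwards [h0] with x hx
    have h1 : pev P x = ‖x‖ ^ d * pev P (‖x‖⁻¹ • x) := by
      rw [← pev_smul hP, smul_smul, mul_inv_cancel₀ (by simpa using hx), one_smul]
    have h2 := hC (‖x‖⁻¹ • x) (by simp [norm_smul, hx])
    rw [h1, norm_mul, norm_mul, ← mul_assoc, norm_of_nonneg (exp_pos _).le, norm_pow, norm_norm,
      mul_comm _ (‖x‖ ^ d)]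
    gcongr
    exact h2.trans (le_max_left _ _)

def GG (a : ℕ) : ℝ := ∫ s in Set.Ioi (0 : ℝ), s ^ a * exp (-s ^ 2)

lemma GG_eq (a : ℕ) : GG a = Gamma ((a + 1) / 2) / 2 := by
  have := integral_rpow_mul_exp_neg_mul_rpow (p := 2) (q := a) (b := 1) (by norm_num)
    (by have : (0 : ℝ) ≤ a := by positivity
        linarith) one_pos
  simp only [rpow_natCast, one_rpow, one_mul, rpow_two, neg_mul] at this
  unfold GG
  rw [this]; ring

lemma GG_pos (a : ℕ) : 0 < GG a := by
  rw [GG_eq]; have := Gamma_pos_of_pos (s := ((a : ℝ) + 1) / 2) (by positivity); positivity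

lemma GG_succ (a : ℕ) : 2 * GG (a + 2) = (a + 1) * GG a := by
  rw [GG_eq, GG_eq]
  have := Gamma_add_one (s := ((a : ℝ) + 1) / 2) (by positivity)
  push_cast
  rw [show ((a : ℝ) + 2 + 1) / 2 = (a + 1) / 2 + 1 by ring, this]; ring

lemma polar_gauss {n d : ℕ} {P : MvPolynomial (Fin (n + 1)) ℝ} (hP : P.IsHomogeneous d) :
    ∫ x : EE n, pev P x * exp (-‖x‖ ^ 2) = (∫ ω : Sph n, pev P ω ∂(sphMeasure n)) * GG (d + n) := by
  calc
    ∫ x : EE n, pev P x * exp (-‖x‖ ^ 2) 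
      = ∫ x : ({(0)}ᶜ : Set (EE n)), pev P x.1 * exp (-‖x.1‖ ^ 2) ∂(volume.comap Subtype.val) := by
      rw [integral_subtype_comap (measurableSet_singleton _).compl fun x : EE n ↦ pev P x * exp (-‖x‖ ^ 2),
        restrict_compl_singleton]
    _ = ∫ x, pev P x.1 * (x.2.1 ^ d * exp (- x.2.1 ^ 2)) ∂(volume : Measure (EE n)).toSphere.prod (.volumeIoiPow (Module.finrank ℝ (EE n) - 1)) := by
      rw [← (volume : Measure (EE n)).measurePreserving_homeomorphUnitSphereProd.integral_comp
        (Homeomorph.measurableEmbedding _)]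
      congr 1
      funext x
      have hx : (x : EE n) ≠ 0 := x.2
      have h1 : pev P (x : EE n) = ‖(x : EE n)‖ ^ d * pev P (‖(x : EE n)‖⁻¹ • (x : EE n)) := by
        rw [← pev_smul hP, smul_smul, mul_inv_cancel₀ (by simpa using hx), one_smul]
      simp [h1]
      ring
    _ = (∫ ω : Sph n, pev P ω ∂(sphMeasure n)) * ∫ x : Set.Ioi (0 : ℝ), (x.1 ^ d * exp (- x.1 ^ 2)) ∂.volumeIoiPow (Module.finrank ℝ (EE n) - 1) := by
      rw [integral_prod_mul (fun ω : Sph n => pev P ω) (fun x : Set.Ioi (0 : ℝ) => x.1 ^ d * exp (- x.1 ^ 2))]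
      rfl
    _ = _ := by
      congr 1
      simp only [Measure.volumeIoiPow, ENNReal.ofReal]
      rw [integral_withDensity_eq_integral_smul,
        integral_subtype_comap measurableSet_Ioi fun a ↦ Real.toNNReal (a ^ (Module.finrank ℝ (EE n) - 1)) • (a ^ d * exp (- a ^ 2)), GG]
      · refine setIntegral_congr_fun measurableSet_Ioi fun x hx ↦ ?_
        simp only [NNReal.smul_def, Real.coe_toNNReal _ (pow_nonneg (le_of_lt hx) _)]
        simp [pow_add]
        ring
      · exact (measurable_subtype_coe.pow_const _).real_toNNReal

lemma gauss_ibp {n d : ℕ} {P : MvPolynomial (Fin (n + 1)) ℝ} (hP : P.IsHomogeneous d) (i : Fin (n + 1)) :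
    ∫ x : EE n, pev (MvPolynomial.pderiv i P) x * exp (-‖x‖ ^ 2) =
      2 * ∫ x : EE n, pev (MvPolynomial.X i * P) x * exp (-‖x‖ ^ 2) := by
  have hd := fun x => (pev_hasFDerivAt P x)
  have hg : ∀ x : EE n, HasFDerivAt (fun x : EE n => exp (-‖x‖ ^ 2)) 
      (exp (-‖x‖ ^ 2) • (-((2 : ℝ) • innerSL ℝ x))) x := by
    intro x
    have := (hasStrictFDerivAt_norm_sq x).hasFDerivAt.neg.exp
    have h2 : (2 : ℝ) • innerSL ℝ x = 2 • innerSL ℝ x := by rw [two_smul, two_nsmul]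
    rw [h2]
    exact this
  have e1 : ∀ x, fderiv ℝ (pev P) x (EuclideanSpace.single i 1) = pev (MvPolynomial.pderiv i P) x := by
    intro x
    rw [(hd x).fderiv]
    simp
  have e2 : ∀ x : EE n, fderiv ℝ (fun x : EE n => exp (-‖x‖ ^ 2)) x (EuclideanSpace.single i 1) 
      = - 2 * x i * exp (-‖x‖ ^ 2) := by
    intro x
    rw [(hg x).fderiv]
    simp [EuclideanSpace.inner_single_right]
    ring
  have hX : (MvPolynomial.X i * P).IsHomogeneous (1 + d) := (MvPolynomial.isHomogeneous_X _ _).mul hP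
  have e3 : ∀ x : EE n, pev (MvPolynomial.X i * P) x = x i * pev P x := by intro x; simp [pev]
  have := integral_mul_fderiv_eq_neg_fderiv_mul_of_integrable (μ := (volume : Measure (EE n)))
    (f := pev P) (g := fun x : EE n => exp (-‖x‖ ^ 2)) (v := EuclideanSpace.single i 1)
    (by simp only [e1]; exact gauss_integrable_homog hP.pderiv)
    (by simp only [e2]
        refine ((gauss_integrable_homog hX).const_mul (-2)).congr (.of_forall fun x => ?_)
        simp only [e3]; ring) (gauss_integrable_homog hP)
    (fun x _ => (hd x).differentiableAt) (fun x _ => (hg x).differentiableAt)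
  simp only [e1, e2] at this
  rw [eq_neg_iff_add_eq_zero, add_comm, ← eq_neg_iff_add_eq_zero] at this
  rw [this, ← integral_neg, ← integral_const_mul]
  congr 1 with x
  rw [e3]; ring

lemma sph_ibp {n d : ℕ} {P : MvPolynomial (Fin (n + 1)) ℝ} (hP : P.IsHomogeneous d) (i : Fin (n + 1)) :
    ∫ ω : Sph n, pev (MvPolynomial.pderiv i P) ω ∂(sphMeasure n) =
      (d + n) * ∫ ω : Sph n, pev (MvPolynomial.X i * P) ω ∂(sphMeasure n) := by
  have h := gauss_ibp hP i
  have hX : (MvPolynomial.X i * P).IsHomogeneous (1 + d) := (MvPolynomial.isHomogeneous_X _ _).mul hP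
  rw [polar_gauss hX] at h
  rcases d with _ | d
  · have h0 : MvPolynomial.pderiv i P = 0 := by
      have := MvPolynomial.totalDegree_eq_zero_iff_eq_C.1 (Nat.le_zero.1 hP.totalDegree_le)
      rw [this]; simp
    simp only [h0, pev, map_zero, zero_mul, integral_zero, zero_eq_mul] at h ⊢
    have := (GG_pos (1 + 0 + n)).ne'
    simp_all
  · rw [polar_gauss hP.pderiv] at h
    have e := GG_succ (d + n)
    have e' := GG_pos (d + n)
    rw [show 1 + (d + 1) + n = d + n + 2 by ring] at h
    simp only [Nat.add_sub_cancel] at h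
    apply mul_right_cancel₀ e'.ne'
    rw [h]
    push_cast at e ⊢
    linear_combination (∫ ω : Sph n, pev (MvPolynomial.X i * P) ω ∂(sphMeasure n)) * e

lemma sph_integrable {n : ℕ} {f : Sph n → ℝ} (hf : Continuous f) : Integrable f (sphMeasure n) := by
  have : IsFiniteMeasure (sphMeasure n) := by unfold sphMeasure; infer_instance
  exact hf.integrable_of_hasCompactSupport (HasCompactSupport.of_compactSpace f)

lemma sph_lap {n d : ℕ} {P : MvPolynomial (Fin (n + 1)) ℝ} (hP : P.IsHomogeneous d) :
    ∫ ω : Sph n, pev (∑ i, MvPolynomial.pderiv i (MvPolynomial.pderiv i P)) ω ∂(sphMeasure n) =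
      d * (d + n - 1) * ∫ ω : Sph n, pev P ω ∂(sphMeasure n) := by
  have hi : ∀ Q : MvPolynomial (Fin (n + 1)) ℝ, Integrable (fun ω : Sph n => pev Q ω) (sphMeasure n) :=
    fun Q => sph_integrable ((pev_continuous Q).comp continuous_subtype_val)
  have hs : ∀ Q : Fin (n + 1) → MvPolynomial (Fin (n + 1)) ℝ, 
     ∫ ω : Sph n, pev (∑ i, Q i) ω ∂(sphMeasure n) = ∑ i, ∫ ω : Sph n, pev (Q i) ω ∂(sphMeasure n) := by
    intro Q
    rw [← integral_finsetSum _ (fun i _ => hi _)]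
    simp [pev]
  rcases d with _ | d
  · have h0 : ∀ i, MvPolynomial.pderiv i P = 0 := by
      have := MvPolynomial.totalDegree_eq_zero_iff_eq_C.1 (Nat.le_zero.1 hP.totalDegree_le)
      rw [this]; simp
    simp [h0, pev]
  rw [hs, Finset.sum_congr rfl (fun i _ => sph_ibp hP.pderiv i), ← Finset.mul_sum, ← hs,
    hP.sum_X_mul_pderiv]
  simp [pev, integral_const_mul]
  ring

/-- the linear form `x ↦ ω · x` as a polynomial -/
def linP {n : ℕ} (w : Fin (n + 1) → ℝ) : MvPolynomial (Fin (n + 1)) ℝ :=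
  ∑ i, MvPolynomial.C (w i) * MvPolynomial.X i

/-- directional derivative -/
def dirD {n : ℕ} (w : Fin (n + 1) → ℝ) (P : MvPolynomial (Fin (n + 1)) ℝ) :
    MvPolynomial (Fin (n + 1)) ℝ :=
  ∑ i, MvPolynomial.C (w i) * MvPolynomial.pderiv i P

/-- Laplacian -/
def lapP {n : ℕ} (P : MvPolynomial (Fin (n + 1)) ℝ) : MvPolynomial (Fin (n + 1)) ℝ :=
  ∑ i, MvPolynomial.pderiv i (MvPolynomial.pderiv i P)

lemma pderiv_linP {n : ℕ} (w : Fin (n + 1) → ℝ) (i : Fin (n + 1)) :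
    MvPolynomial.pderiv i (linP w) = MvPolynomial.C (w i) := by
  unfold linP
  rw [map_sum, Finset.sum_eq_single i]
  · simp
  · intro b _ hb
    simp [MvPolynomial.pderiv_X_of_ne hb]
  · simp

lemma linP_hom {n : ℕ} (w : Fin (n + 1) → ℝ) : (linP w).IsHomogeneous 1 := by
  unfold linP
  refine MvPolynomial.IsHomogeneous.sum _ _ _ fun i _ => ?_
  simpa using (MvPolynomial.isHomogeneous_C (Fin (n + 1)) (w i)).mul (MvPolynomial.isHomogeneous_X ℝ i)

lemma dirD_hom {n d : ℕ} (w : Fin (n + 1) → ℝ) {P : MvPolynomial (Fin (n + 1)) ℝ}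
    (hP : P.IsHomogeneous d) : (dirD w P).IsHomogeneous (d - 1) := by
  unfold dirD
  refine MvPolynomial.IsHomogeneous.sum _ _ _ fun i _ => ?_
  simpa using (MvPolynomial.isHomogeneous_C (Fin (n + 1)) (w i)).mul hP.pderiv

lemma pderiv_comm' {n : ℕ} (i j : Fin (n + 1)) (P : MvPolynomial (Fin (n + 1)) ℝ) :
    MvPolynomial.pderiv i (MvPolynomial.pderiv j P) = MvPolynomial.pderiv j (MvPolynomial.pderiv i P) := by
  induction P using MvPolynomial.induction_on with
  | C a => simp
  | add p q hp hq => simp [hp, hq]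
  | mul_X p k hp =>
    simp only [MvPolynomial.pderiv_mul, map_add, hp, MvPolynomial.pderiv_X, Pi.single_apply]
    split_ifs <;> simp <;> ring

lemma lapP_dirD {n : ℕ} (w : Fin (n + 1) → ℝ) (P : MvPolynomial (Fin (n + 1)) ℝ) :
    lapP (dirD w P) = dirD w (lapP P) := by
  unfold lapP dirD
  simp only [map_sum, MvPolynomial.pderiv_C_mul, Finset.mul_sum]
  rw [Finset.sum_comm]
  refine Finset.sum_congr rfl fun i _ => Finset.sum_congr rfl fun j _ => ?_
  rw [pderiv_comm' j i P, pderiv_comm' j i]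

lemma lapP_mul_pow {n : ℕ} (w : Fin (n + 1) → ℝ) (hw : ∑ i, w i ^ 2 = 1)
    (P : MvPolynomial (Fin (n + 1)) ℝ) (hP : lapP P = 0) (k : ℕ) :
    lapP (P * linP w ^ (k + 2)) = (2 * ((k : ℝ) + 2)) • (dirD w P * linP w ^ (k + 1)) +
      (((k : ℝ) + 2) * (k + 1)) • (P * linP w ^ k) := by
  have h1 : ∀ i, MvPolynomial.pderiv i (MvPolynomial.pderiv i (P * linP w ^ (k + 2))) =
      MvPolynomial.pderiv i (MvPolynomial.pderiv i P) * linP w ^ (k + 2) +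
      MvPolynomial.C (2 * ((k : ℝ) + 2)) * ((MvPolynomial.C (w i) * MvPolynomial.pderiv i P) * linP w ^ (k + 1)) +
      MvPolynomial.C (((k : ℝ) + 2) * (k + 1)) * (P * linP w ^ k) * MvPolynomial.C (w i ^ 2) := by
    intro i
    have hC2 : (MvPolynomial.C (2 : ℝ) : MvPolynomial (Fin (n + 1)) ℝ) = 2 := map_ofNat _ 2
    have hC3 : MvPolynomial.pderiv i (2 : MvPolynomial (Fin (n + 1)) ℝ) = 0 := by
      rw [← hC2, MvPolynomial.pderiv_C]
    simp [pderiv_linP, hC2, hC3]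
    ring
  have h2 : lapP (P * linP w ^ (k + 2)) = lapP P * linP w ^ (k + 2) +
      MvPolynomial.C (2 * ((k : ℝ) + 2)) * (dirD w P * linP w ^ (k + 1)) +
      MvPolynomial.C (((k : ℝ) + 2) * (k + 1)) * (P * linP w ^ k) * MvPolynomial.C (∑ i, w i ^ 2) := by
    conv_lhs => unfold lapP
    simp only [h1, Finset.sum_add_distrib]
    simp only [lapP, dirD, Finset.sum_mul, Finset.mul_sum, map_sum]
  rw [h2, hP, hw, MvPolynomial.smul_eq_C_mul, MvPolynomial.smul_eq_C_mul]
  simp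

lemma lapP_mul_one {n : ℕ} (w : Fin (n + 1) → ℝ)
    (P : MvPolynomial (Fin (n + 1)) ℝ) (hP : lapP P = 0) :
    lapP (P * linP w ^ 1) = (2 : ℝ) • dirD w P := by
  have h1 : ∀ i, MvPolynomial.pderiv i (MvPolynomial.pderiv i (P * linP w ^ 1)) =
      MvPolynomial.pderiv i (MvPolynomial.pderiv i P) * linP w +
      MvPolynomial.C 2 * ((MvPolynomial.C (w i) * MvPolynomial.pderiv i P)) := by
    intro i
    have hC2 : (MvPolynomial.C (2 : ℝ) : MvPolynomial (Fin (n + 1)) ℝ) = 2 := map_ofNat _ 2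
    simp [pderiv_linP, hC2]
    ring
  have h2 : lapP (P * linP w ^ 1) = lapP P * linP w + MvPolynomial.C 2 * dirD w P := by
    conv_lhs => unfold lapP
    simp only [h1, Finset.sum_add_distrib]
    simp only [lapP, dirD, Finset.sum_mul, Finset.mul_sum]
  rw [h2, hP, MvPolynomial.smul_eq_C_mul]
  simp

lemma pev_dirD_self {n d : ℕ} (w : EE n) {P : MvPolynomial (Fin (n + 1)) ℝ}
    (hP : P.IsHomogeneous d) : pev (dirD (fun i => w i) P) w = d * pev P w := by
  have := congrArg (fun Q => pev Q w) hP.sum_X_mul_pderiv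
  simpa [pev, dirD] using this

/-- sphere integral of a polynomial -/
def sint {n : ℕ} (P : MvPolynomial (Fin (n + 1)) ℝ) : ℝ := ∫ ω : Sph n, pev P ω ∂(sphMeasure n)

lemma sint_lap {n d : ℕ} {P : MvPolynomial (Fin (n + 1)) ℝ} (hP : P.IsHomogeneous d) :
    sint (lapP P) = d * (d + n - 1) * sint P := sph_lap hP

lemma pev_integrable {n : ℕ} (Q : MvPolynomial (Fin (n + 1)) ℝ) :
    Integrable (fun ω : Sph n => pev Q ω) (sphMeasure n) :=
  sph_integrable ((pev_continuous Q).comp continuous_subtype_val)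

lemma sint_add {n : ℕ} (P Q : MvPolynomial (Fin (n + 1)) ℝ) : sint (P + Q) = sint P + sint Q := by
  unfold sint
  rw [← integral_add (pev_integrable P) (pev_integrable Q)]
  simp [pev]

lemma sint_smul {n : ℕ} (c : ℝ) (P : MvPolynomial (Fin (n + 1)) ℝ) : sint (c • P) = c * sint P := by
  unfold sint
  rw [← integral_const_mul]
  simp [pev]

lemma sint_one {n : ℕ} : sint (1 : MvPolynomial (Fin (n + 1)) ℝ) =
    2 * π ^ (((n : ℝ) + 1) / 2) / Gamma (((n : ℝ) + 1) / 2) := by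
  unfold sint
  have h : (0 : ℝ) < ((n : ℝ) + 1) / 2 := by positivity
  have h2 := (Gamma_pos_of_pos h).ne'
  have h3 := Gamma_add_one h.ne'
  simp only [pev, map_one, integral_const, smul_eq_mul, mul_one, sphMeasure]
  rw [Measure.toSphere_real_apply_univ, finrank_euclideanSpace, Fintype.card_fin, Measure.real,
    EuclideanSpace.volume_ball, Fintype.card_fin]
  have h4 : √π ^ (n + 1) = π ^ (((n : ℝ) + 1) / 2) := by
    rw [sqrt_eq_rpow, ← rpow_natCast, ← rpow_mul pi_pos.le]
    congr 1; push_cast; ring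
  have h5 : (0 : ℝ) ≤ √π ^ (n + 1) / Gamma (((n + 1 : ℕ) : ℝ) / 2 + 1) := by
    push_cast; rw [h3]
    have := Gamma_pos_of_pos h
    positivity
  simp only [ENNReal.ofReal_one, one_pow, one_mul]
  rw [ENNReal.toReal_ofReal h5, h4]
  push_cast
  rw [h3]
  field_simp

/-- the moment coefficient -/
def mc (n l j : ℕ) : ℝ := ((l + 2 * j).factorial : ℝ) / (j.factorial * 2 ^ (l + 2 * j)) *
  (2 * π ^ (((n : ℝ) + 1) / 2)) / Gamma ((l : ℝ) + j + ((n : ℝ) + 1) / 2)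

lemma mc_rec1 (n l : ℕ) : ((l : ℝ) + 1 + l + 1) * ((l : ℝ) + 1 + l + 1 + n - 1) * mc n (l + 1) 0 =
    2 * (l + 1) * (mc n l 0 * (l + 1)) := by
  unfold mc
  have h : (0 : ℝ) < (l : ℝ) + ((n : ℝ) + 1) / 2 := by positivity
  have h2 := (Gamma_pos_of_pos h).ne'
  have h3 := Gamma_add_one h.ne'
  simp only [Nat.mul_zero, Nat.add_zero, Nat.factorial_succ]
  push_cast
  rw [add_zero, add_zero, show (l : ℝ) + 1 + ((n : ℝ) + 1) / 2 = l + ((n : ℝ) + 1) / 2 + 1 by ring, h3]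
  have : (l : ℝ) * 2 + ((n : ℝ) + 1) ≠ 0 := by positivity
  field_simp
  ring

lemma mc_rec2 (n l j : ℕ) : ((l : ℝ) + (l + 2 * (j + 1))) * ((l : ℝ) + (l + 2 * (j + 1)) + n - 1) * mc n l (j + 1) =
    2 * (l + 2 * (j + 1)) * ((if l = 0 then 0 else mc n (l - 1) (j + 1)) * l) +
      (l + 2 * (j + 1)) * (l + 2 * (j + 1) - 1) * mc n l j := by
  have h : (0 : ℝ) < (l : ℝ) + j + ((n : ℝ) + 1) / 2 := by positivity
  have h2 := (Gamma_pos_of_pos h).ne'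
  have h3 := Gamma_add_one h.ne'
  have : (l : ℝ) * 2 + 2 * j + ((n : ℝ) + 1) ≠ 0 := by positivity
  rcases l with _ | l
  · simp only [if_true, mc]
    rw [show 0 + 2 * (j + 1) = (0 + 2 * j + 1) + 1 by ring]
    simp only [Nat.factorial_succ]
    push_cast at h h2 h3 this ⊢
    rw [show (0 : ℝ) + (j + 1) + ((n : ℝ) + 1) / 2 = 0 + j + ((n : ℝ) + 1) / 2 + 1 by ring, h3]
    field_simp
    ring
  · simp only [mc, Nat.add_sub_cancel]
    rw [if_neg (by omega), show l + 1 + 2 * (j + 1) = (l + 2 * j + 1 + 1) + 1 by ring,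
      show l + 2 * (j + 1) = l + 2 * j + 1 + 1 by ring, show l + 1 + 2 * j = l + 2 * j + 1 by ring]
    simp only [Nat.factorial_succ]
    push_cast at h h2 h3 this ⊢
    rw [show (l : ℝ) + 1 + (j + 1) + ((n : ℝ) + 1) / 2 = l + 1 + j + ((n : ℝ) + 1) / 2 + 1 by ring, h3,
      show (l : ℝ) + (j + 1) + ((n : ℝ) + 1) / 2 = l + 1 + j + ((n : ℝ) + 1) / 2 by ring]
    field_simp
    ring

lemma moment {n : ℕ} (hn : 1 ≤ n) (w : EE n) (hw : ∑ i, w i ^ 2 = 1) (k : ℕ) :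
    ∀ (l : ℕ) (P : MvPolynomial (Fin (n + 1)) ℝ), P.IsHomogeneous l → lapP P = 0 →
      (∀ j, k = l + 2 * j → sint (P * linP (fun i => w i) ^ k) = mc n l j * pev P w) ∧
      ((∀ j, k ≠ l + 2 * j) → sint (P * linP (fun i => w i) ^ k) = 0) := by
  induction k using Nat.strong_induction_on with
  | _ k ih =>
  intro l P hP hl
  have hn' : (1 : ℝ) ≤ n := by exact_mod_cast hn
  have hD0 : l = 0 → dirD (fun i => w i) P = 0 := by
    rintro rfl
    have := MvPolynomial.totalDegree_eq_zero_iff_eq_C.1 (Nat.le_zero.1 hP.totalDegree_le)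
    rw [this]; simp [dirD]
  have hDl : lapP (dirD (fun i => w i) P) = 0 := by
    rw [lapP_dirD, hl]; simp [dirD]
  have hDh := dirD_hom (fun i => w i) hP
  have hDe := pev_dirD_self w hP
  have hh := hP.mul ((linP_hom (fun i => w i)).pow k)
  rw [one_mul] at hh
  have hL := sint_lap hh
  rcases k with _ | _ | k
  · simp only [pow_zero, mul_one, Nat.add_zero] at hL ⊢
    rw [hl] at hL
    have h0 : sint (0 : MvPolynomial (Fin (n + 1)) ℝ) = 0 := by simp [sint, pev]
    rw [h0] at hL
    constructor
    · intro j hj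
      obtain ⟨rfl, rfl⟩ : l = 0 ∧ j = 0 := by omega
      have h1 := MvPolynomial.totalDegree_eq_zero_iff_eq_C.1 (Nat.le_zero.1 hP.totalDegree_le)
      have h2 : P = (pev P w) • 1 := by
        conv_lhs => rw [h1]
        rw [MvPolynomial.smul_eq_C_mul, mul_one]
        conv_rhs => rw [h1]
        simp [pev]
      conv_lhs => rw [h2]
      rw [sint_smul, sint_one, mc]
      simp
      ring
    · intro hj
      have : l ≠ 0 := fun h => hj 0 (by omega)
      have : (1 : ℝ) ≤ l := by exact_mod_cast Nat.one_le_iff_ne_zero.2 this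
      have h3 : (l : ℝ) * (l + n - 1) ≠ 0 := by
        have : (0 : ℝ) < l * (l + n - 1) := by apply mul_pos <;> linarith
        exact this.ne'
      rcases mul_eq_zero.1 hL.symm with h | h
      · exact absurd h h3
      · exact h
  · rw [lapP_mul_one _ _ hl, sint_smul] at hL
    have hpos : (0 : ℝ) < ((l + 1 : ℕ) : ℝ) * (((l + 1 : ℕ) : ℝ) + n - 1) := by
      push_cast
      have : (0 : ℝ) ≤ l := by positivity
      apply mul_pos <;> linarith
    have hD := ih 0 (by omega) (l - 1) _ hDh hDl
    simp only [pow_zero, mul_one] at hD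
    constructor
    · intro j hj
      obtain ⟨rfl, rfl⟩ : l = 1 ∧ j = 0 := by omega
      rw [hD.1 0 (by omega), hDe] at hL
      apply mul_left_cancel₀ hpos.ne'
      refine hL.symm.trans ?_
      have := mc_rec1 n 0
      push_cast at this ⊢
      simp at this ⊢
      linear_combination (-pev P w) * this
    · intro hj
      apply mul_left_cancel₀ hpos.ne'
      refine hL.symm.trans ?_
      by_cases h0 : l = 0
      · rw [hD0 h0]; simp [sint, pev]
      · rw [hD.2 (fun j hj' => hj j (by omega))]; simp
  · rw [lapP_mul_pow _ hw _ hl, sint_add, sint_smul, sint_smul] at hL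
    have hpos : (0 : ℝ) < ((l + (k + 1 + 1) : ℕ) : ℝ) * (((l + (k + 1 + 1) : ℕ) : ℝ) + n - 1) := by
      push_cast
      have : (0 : ℝ) ≤ l := by positivity
      have : (0 : ℝ) ≤ k := by positivity
      apply mul_pos <;> linarith
    have hD := ih (k + 1) (by omega) (l - 1) _ hDh hDl
    have hK := ih k (by omega) l _ hP hl
    have hz : l = 0 → sint (dirD (fun i => w i) P * linP (fun i => w i) ^ (k + 1)) = 0 := by
      intro h0
      rw [hD0 h0]; simp [sint, pev]
    constructor
    · intro j hj
      apply mul_left_cancel₀ hpos.ne'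
      refine hL.symm.trans ?_
      rcases j with _ | j
      · obtain rfl : l = k + 2 := by omega
        rw [hD.1 0 (by omega), hDe, hK.2 (by intro j; omega)]
        have := mc_rec1 n (k + 1)
        simp only [show k + 2 - 1 = k + 1 by omega, show k + 1 + 1 = k + 2 by omega] at this ⊢
        push_cast at this ⊢
        linear_combination (-pev P w) * this
      · obtain rfl : k = l + 2 * j := by omega
        rw [hK.1 j rfl]
        have := mc_rec2 n l j
        by_cases h0 : l = 0
        · rw [hz h0]
          rw [if_pos h0] at this
          push_cast at this ⊢
          linear_combination (-pev P w) * this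
        · rw [hD.1 (j + 1) (by omega), hDe]
          rw [if_neg h0] at this
          push_cast at this ⊢
          linear_combination (-pev P w) * this
    · intro hj
      apply mul_left_cancel₀ hpos.ne'
      refine hL.symm.trans ?_
      rw [hK.2 (fun j hj' => hj (j + 1) (by omega))]
      by_cases h0 : l = 0
      · rw [hz h0]; simp
      · rw [hD.2 (fun j hj' => hj j (by omega))]; simp

def cc (a : ℝ) (j : ℕ) : ℝ :=
  Gamma (a / 2 + j) * Gamma (a / 2 + 1 / 2 + j) / (j.factorial * Gamma (a + 1 / 2 + j))

lemma cc_diff {a : ℝ} (ha : 0 < a) (j : ℕ) : cc a j - cc (a + 1) j =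
    2 / a * (((j + 1 : ℕ) : ℝ) * cc a (j + 1) - j * cc a j) := by
  unfold cc
  have h1 : 0 < a / 2 + j := by positivity
  have h2 : 0 < a / 2 + 1 / 2 + j := by positivity
  have h3 : 0 < a + 1 / 2 + j := by positivity
  have g1 := Gamma_add_one h1.ne'
  have g2 := Gamma_add_one h2.ne'
  have g3 := Gamma_add_one h3.ne'
  have p3 := (Gamma_pos_of_pos h3).ne'
  push_cast [Nat.factorial_succ]
  rw [show (a + 1) / 2 + j = a / 2 + 1 / 2 + j by ring,
    show (a + 1) / 2 + 1 / 2 + j = a / 2 + j + 1 by ring,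
    show a + 1 + 1 / 2 + j = a + 1 / 2 + j + 1 by ring,
    show a / 2 + (j + 1 : ℝ) = a / 2 + j + 1 by ring,
    show a / 2 + 1 / 2 + (j + 1 : ℝ) = a / 2 + 1 / 2 + j + 1 by ring,
    show a + 1 / 2 + (j + 1 : ℝ) = a + 1 / 2 + j + 1 by ring, g1, g2, g3]
  have : (j.factorial : ℝ) ≠ 0 := by positivity
  generalize Gamma (a / 2 + j) = A at *
  generalize Gamma (a / 2 + 1 / 2 + j) = B at *
  generalize Gamma (a + 1 / 2 + j) = G at *
  have h4 : a * 2 + 1 + 2 * j ≠ 0 := by positivity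
  field_simp
  ring

lemma Gamma_prod {s : ℝ} (hs : 0 < s) (j : ℕ) :
    Gamma (s + j) = Gamma s * ∏ i ∈ Finset.range j, (s + i) := by
  induction j with
  | zero => simp
  | succ j ih =>
    rw [Finset.prod_range_succ, ← mul_assoc, ← ih]
    push_cast
    rw [← add_assoc, Gamma_add_one (by positivity)]
    ring

lemma Gamma_ratio {s : ℝ} (hs : 0 < s) :
    Filter.Tendsto (fun j : ℕ => (j : ℝ) ^ s * j.factorial / Gamma (s + j + 1)) Filter.atTop (nhds 1) := by
  have h := (GammaSeq_tendsto_Gamma s).div_const (Gamma s)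
  have hp := (Gamma_pos_of_pos hs).ne'
  rw [div_self hp] at h
  refine h.congr fun j => ?_
  have := Gamma_prod hs (j + 1)
  push_cast at this
  rw [GammaSeq, add_assoc, this, div_div]
  congr 1; ring

lemma cc_tendsto {a : ℝ} (ha : 0 < a) :
    Filter.Tendsto (fun j : ℕ => (j : ℝ) * cc a j) Filter.atTop (nhds 1) := by
  rw [← Filter.tendsto_add_atTop_iff_nat 1]
  have h1 := Gamma_ratio (s := a / 2) (by positivity)
  have h2 := Gamma_ratio (s := a / 2 + 1 / 2) (by positivity)
  have h3 := Gamma_ratio (s := a + 1 / 2) (by positivity)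
  have h := h3.div (h1.mul h2) (by norm_num)
  rw [mul_one, div_one] at h
  refine h.congr' ?_
  filter_upwards [Filter.eventually_gt_atTop 0] with j hj
  have hj' : (0 : ℝ) < j := by exact_mod_cast hj
  simp only [cc, Pi.div_apply]
  push_cast [Nat.factorial_succ]
  rw [show a + 1 / 2 = a / 2 + (a / 2 + 1 / 2) by ring, rpow_add hj']
  simp only [← add_assoc]
  have p1 := (Gamma_pos_of_pos (s := a / 2 + j + 1) (by positivity)).ne'
  have p2 := (Gamma_pos_of_pos (s := a / 2 + 1 / 2 + j + 1) (by positivity)).ne'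
  have p3 := (Gamma_pos_of_pos (s := a / 2 + a / 2 + 1 / 2 + j + 1) (by positivity)).ne'
  have q1 := (rpow_pos_of_pos hj' (a / 2)).ne'
  have q2 := (rpow_pos_of_pos hj' (a / 2 + 1 / 2)).ne'
  have : (j.factorial : ℝ) ≠ 0 := by positivity
  have : (j : ℝ) + 1 ≠ 0 := by positivity
  generalize (j : ℝ) ^ (a / 2) = X at *
  generalize (j : ℝ) ^ (a / 2 + 1 / 2) = Z at *
  generalize Gamma (a / 2 + j + 1) = A at *
  generalize Gamma (a / 2 + 1 / 2 + j + 1) = B at *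
  generalize Gamma (a / 2 + a / 2 + 1 / 2 + j + 1) = G at *
  field_simp

lemma cc_tendsto_zero {a : ℝ} (ha : 0 < a) : Filter.Tendsto (cc a) Filter.atTop (nhds 0) := by
  have h := (cc_tendsto ha).mul (tendsto_inv_atTop_nhds_zero_nat (𝕜 := ℝ))
  rw [mul_zero] at h
  refine h.congr' ?_
  filter_upwards [Filter.eventually_gt_atTop 0] with j hj
  have hj' : (j : ℝ) ≠ 0 := by positivity
  field_simp

lemma cc_summable {a : ℝ} (ha : 0 < a) {x : ℝ} (hx0 : 0 ≤ x) (hx : x < 1) :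
    Summable (fun j => cc a j * x ^ j) := by
  obtain ⟨C, hC⟩ := (cc_tendsto_zero ha).bddAbove_range.imp fun C h => h
  obtain ⟨D, hD⟩ := (cc_tendsto_zero ha).bddBelow_range.imp fun C h => h
  refine Summable.of_norm_bounded ((summable_geometric_of_lt_one hx0 hx).mul_left (max C (-D))) fun j => ?_
  rw [norm_mul, norm_of_nonneg (pow_nonneg hx0 j)]
  gcongr
  have h1 := hC ⟨j, rfl⟩
  have h2 := hD ⟨j, rfl⟩
  rw [norm_eq_abs, abs_le']
  exact ⟨h1.trans (le_max_left _ _), (neg_le_neg h2).trans (le_max_right _ _)⟩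

lemma sq_tendsto : Filter.Tendsto (fun r : ℝ => r ^ 2) (nhdsWithin 1 (Set.Iio 1)) (nhdsWithin 1 (Set.Iio 1)) := by
  refine tendsto_nhdsWithin_iff.2 ⟨?_, ?_⟩
  · have : Continuous (fun r : ℝ => r ^ 2) := by fun_prop
    simpa using (this.tendsto 1).mono_left nhdsWithin_le_nhds
  · filter_upwards [Ioo_mem_nhdsLT (show (0 : ℝ) < 1 by norm_num)] with r hr
    have h1 := hr.1
    have h2 := hr.2
    simp only [Set.mem_Iio]
    nlinarith

lemma abel_gen (c : ℕ → ℝ) (hc : Filter.Tendsto c Filter.atTop (nhds 0))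
    (hsum : ∀ x : ℝ, 0 ≤ x → x < 1 → Summable (fun j => c j * x ^ j)) :
    Filter.Tendsto (fun x : ℝ => (1 - x) * ∑' j, c j * x ^ j)
    (nhdsWithin 1 (Set.Iio 1)) (nhds 0) := by
  obtain ⟨f, hf0, hf1⟩ : ∃ f : ℕ → ℝ, f 0 = c 0 ∧ ∀ j, f (j + 1) = c (j + 1) - c j :=
    ⟨fun j => if j = 0 then c 0 else c j - c (j - 1), by simp, by simp⟩
  have hf : ∀ J, ∑ i ∈ Finset.range (J + 1), f i = c J := by
    intro J
    induction J with
    | zero => simp [hf0]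
    | succ J ih => rw [Finset.sum_range_succ, ih, hf1]; ring
  have h1 : Filter.Tendsto (fun J ↦ ∑ i ∈ Finset.range J, f i) Filter.atTop (nhds 0) := by
    rw [← Filter.tendsto_add_atTop_iff_nat 1]
    exact hc.congr fun J => (hf J).symm
  have key : ∀ x : ℝ, 0 ≤ x → x < 1 → ∑' j, f j * x ^ j = (1 - x) * ∑' j, c j * x ^ j := by
    intro x hx0 hx1
    have hs := hsum x hx0 hx1
    have hs1 : Summable (fun j => c (j + 1) * x ^ (j + 1)) :=
      (summable_nat_add_iff (f := fun j => c j * x ^ j) 1).2 hs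
    have e : ∀ j, f (j + 1) * x ^ (j + 1) = c (j + 1) * x ^ (j + 1) - x * (c j * x ^ j) := by
      intro j; rw [hf1]; ring
    have hfs : Summable (fun j => f (j + 1) * x ^ (j + 1)) :=
      (hs1.sub (hs.mul_left x)).congr fun j => by rw [e]
    have hfs' : Summable (fun j => f j * x ^ j) :=
      (summable_nat_add_iff (f := fun j => f j * x ^ j) 1).1 hfs
    have e1 := hfs'.tsum_eq_zero_add
    have e2 := hs.tsum_eq_zero_add
    have e3 : ∑' j, f (j + 1) * x ^ (j + 1) = ∑' j, c (j + 1) * x ^ (j + 1) - x * ∑' j, c j * x ^ j := by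
      rw [← tsum_mul_left, ← hs1.tsum_sub (hs.mul_left x)]
      exact tsum_congr e
    rw [e1, e3, hf0]
    simp only [pow_zero, mul_one] at e2 ⊢
    linarith
  refine (tendsto_tsum_powerSeries_nhdsWithin_lt h1).congr' ?_
  filter_upwards [Ioo_mem_nhdsLT (show (0 : ℝ) < 1 by norm_num)] with x hx
  exact key x hx.1.le hx.2

lemma abel_one {a : ℝ} (ha : 0 < a) : Filter.Tendsto (fun x : ℝ => (1 - x) * ∑' j, cc a j * x ^ j)
    (nhdsWithin 1 (Set.Iio 1)) (nhds 0) :=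
  abel_gen (cc a) (cc_tendsto_zero ha) (fun _ h0 h1 => cc_summable ha h0 h1)

lemma abel_two {a : ℝ} (ha : 0 < a) :
    Filter.Tendsto (fun r : ℝ => (∑' j, cc a j * (r ^ 2) ^ j) - r * ∑' j, cc (a + 1) j * (r ^ 2) ^ j)
    (nhdsWithin 1 (Set.Iio 1)) (nhds (2 / a)) := by
  have h1 : Filter.Tendsto (fun J ↦ ∑ i ∈ Finset.range J, (cc a i - cc (a + 1) i)) Filter.atTop
      (nhds (2 / a)) := by
    have := (cc_tendsto ha).const_mul (2 / a)
    rw [mul_one] at this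
    refine this.congr fun J => ?_
    simp only [cc_diff ha]
    rw [← Finset.mul_sum, Finset.sum_range_sub (fun j => (j : ℝ) * cc a j)]
    simp
  have h2 := (tendsto_tsum_powerSeries_nhdsWithin_lt h1).comp sq_tendsto
  have h3 := (abel_one (a := a + 1) (by positivity)).comp sq_tendsto
  have h4 : Filter.Tendsto (fun r : ℝ => (1 + r)⁻¹) (nhdsWithin 1 (Set.Iio 1)) (nhds (1 + 1)⁻¹) := by
    have : ContinuousAt (fun r : ℝ => (1 + r)⁻¹) 1 := by
      apply ContinuousAt.inv₀ (by fun_prop) (by norm_num)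
    exact this.tendsto.mono_left nhdsWithin_le_nhds
  have h5 := h2.add (h4.mul h3)
  rw [mul_zero, add_zero] at h5
  refine h5.congr' ?_
  filter_upwards [Ioo_mem_nhdsLT (show (0 : ℝ) < 1 by norm_num)] with r hr
  have hx : r ^ 2 < 1 := by have := hr.1; have := hr.2; nlinarith
  have hx0 : 0 ≤ r ^ 2 := by positivity
  have hs1 := cc_summable ha hx0 hx
  have hs2 := cc_summable (a := a + 1) (by positivity) hx0 hx
  simp only [Function.comp]
  simp only [sub_mul (cc a _)]
  rw [hs1.tsum_sub hs2]
  have : 1 + r ≠ 0 := by have := hr.1; positivity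
  field_simp
  ring

def FF (ν : ℝ) (l : ℕ) (r : ℝ) : ℝ := r ^ l * ∑' j, cc (ν + l) j * (r ^ 2) ^ j

lemma FF_tendsto {ν : ℝ} (hν : 0 < ν) (l : ℕ) :
    Filter.Tendsto (fun r => FF ν 0 r - FF ν l r) (nhdsWithin 1 (Set.Iio 1))
      (nhds (∑ k ∈ Finset.range l, 2 / (ν + k))) := by
  induction l with
  | zero => simp
  | succ l ih =>
    rw [Finset.sum_range_succ]
    have h1 := abel_two (a := ν + l) (by positivity)
    have h2 : Filter.Tendsto (fun r : ℝ => r ^ l) (nhdsWithin 1 (Set.Iio 1)) (nhds 1) := by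
      have : Continuous (fun r : ℝ => r ^ l) := by fun_prop
      simpa using (this.tendsto 1).mono_left nhdsWithin_le_nhds
    have h3 := ih.add (h2.mul h1)
    rw [one_mul] at h3
    refine h3.congr fun r => ?_
    simp only [FF]
    push_cast
    rw [← add_assoc ν]
    ring

lemma digamma_sum {ν : ℝ} (hν : 0 < ν) (l : ℕ) :
    digamma (ν + l) - digamma ν = ∑ k ∈ Finset.range l, 1 / (ν + k) := by
  induction l with
  | zero => simp
  | succ l ih =>
    rw [Finset.sum_range_succ, ← ih]
    have hp : 0 < ν + l := by positivity
    have hd : DifferentiableAt ℝ Gamma (ν + l) := differentiableAt_Gamma (fun m => by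
      have : (0 : ℝ) ≤ m := by positivity
      linarith)
    have hd1 : DifferentiableAt ℝ Gamma (ν + l + 1) := differentiableAt_Gamma (fun m => by
      have : (0 : ℝ) ≤ m := by positivity
      linarith)
    have h1 : HasDerivAt (fun x => Gamma (x + 1)) (deriv Gamma (ν + l + 1)) (ν + l) := by
      simpa using hd1.hasDerivAt.comp_add_const (ν + l) 1
    have h2 : HasDerivAt (fun x => x * Gamma x) (1 * Gamma (ν + l) + (ν + l) * deriv Gamma (ν + l)) (ν + l) :=
      (hasDerivAt_id (ν + l)).mul hd.hasDerivAt
    have h3 : (fun x => Gamma (x + 1)) =ᶠ[nhds (ν + l)] (fun x => x * Gamma x) := by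
      filter_upwards [lt_mem_nhds hp] with x hx
      exact Gamma_add_one hx.ne'
    have h4 := (h1.congr_of_eventuallyEq h3.symm).unique h2
    simp only [digamma]
    push_cast
    rw [← add_assoc, h4, Gamma_add_one hp.ne']
    have := (Gamma_pos_of_pos hp).ne'
    have := hp.ne'
    field_simp
    ring

def bb (ν : ℝ) (k : ℕ) : ℝ := Gamma (ν + k) / (Gamma ν * k.factorial)

lemma bb_nonneg {ν : ℝ} (hν : 0 < ν) (k : ℕ) : 0 ≤ bb ν k := by
  unfold bb
  have h1 := Gamma_pos_of_pos hν
  have h2 := Gamma_pos_of_pos (s := ν + k) (by positivity)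
  positivity

lemma bb_hasSum {ν : ℝ} (hν : 0 < ν) {x : ℝ} (hx : |x| < 1) :
    HasSum (fun k => bb ν k * x ^ k) ((1 - x) ^ (-ν)) := by
  have h := (one_div_one_sub_rpow_hasFPowerSeriesOnBall_zero ν).hasSum (y := x) (by
    simpa [enorm_eq_nnnorm] using! hx)
  have h1 : 0 ≤ 1 - x := by linarith [(abs_lt.1 hx).2]
  rw [zero_add, one_div, ← rpow_neg h1] at h
  refine h.congr_fun ?_
  intro k
  have h2 : Ring.choose (ν + k - 1) k = bb ν k := by
    have h3 := Ring.factorial_nsmul_multichoose_eq_ascPochhammer ν k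
    rw [Polynomial.ascPochhammer_smeval_eq_eval] at h3
    have h4 : (ascPochhammer ℝ k).eval ν = ∏ i ∈ Finset.range k, (ν + i) := by
      clear h3
      induction k with
      | zero => simp
      | succ k ih => rw [ascPochhammer_succ_eval, ih, Finset.prod_range_succ]
    have h5 := (Gamma_pos_of_pos hν).ne'
    have h6 : (k.factorial : ℝ) ≠ 0 := by positivity
    rw [h4, nsmul_eq_mul] at h3
    rw [Ring.choose, show ν + k - 1 - k + 1 = ν by ring, bb, Gamma_prod hν, ← h3]
    field_simp
  simp [h2, mul_comm]

lemma mc_bb {n : ℕ} (hn : 1 ≤ n) (l j : ℕ) : bb ((n : ℝ) / 2) (l + 2 * j) * mc n l j =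
    2 ^ ((n : ℝ) / 2) * π ^ ((n : ℝ) / 2) / Gamma ((n : ℝ) / 2) * cc ((n : ℝ) / 2 + l) j := by
  have hn' : (0 : ℝ) < n := by exact_mod_cast hn
  have hd := Gamma_mul_Gamma_add_half (((n : ℝ) / 2 + l) / 2 + j)
  have e0 : 2 * (((n : ℝ) / 2 + l) / 2 + j) = (n : ℝ) / 2 + ((l + 2 * j : ℕ) : ℝ) := by push_cast; ring
  have e1 : (2 : ℝ) ^ (1 - ((n : ℝ) / 2 + ((l + 2 * j : ℕ) : ℝ))) = 2 / (2 ^ ((n : ℝ) / 2) * 2 ^ (l + 2 * j)) := by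
    rw [rpow_sub two_pos, rpow_add two_pos, rpow_one, rpow_natCast]
  have e2 : π ^ (((n : ℝ) + 1) / 2) = π ^ ((n : ℝ) / 2) * √π := by
    rw [sqrt_eq_rpow, ← rpow_add pi_pos]; congr 1; ring
  unfold bb mc cc
  rw [show ((n : ℝ) / 2 + l) / 2 + 1 / 2 + j = ((n : ℝ) / 2 + l) / 2 + j + 1 / 2 by ring, hd, e0, e1, e2,
    show (l : ℝ) + j + ((n : ℝ) + 1) / 2 = (n : ℝ) / 2 + l + 1 / 2 + j by ring]
  have p1 := (Gamma_pos_of_pos (s := (n : ℝ) / 2) (by positivity)).ne'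
  have p2 := (Gamma_pos_of_pos (s := (n : ℝ) / 2 + l + 1 / 2 + j) (by positivity)).ne'
  have p3 := (rpow_pos_of_pos (two_pos : (0 : ℝ) < 2) ((n : ℝ) / 2)).ne'
  have p4 : ((l + 2 * j).factorial : ℝ) ≠ 0 := by positivity
  have p5 : (j.factorial : ℝ) ≠ 0 := by positivity
  generalize Gamma ((n : ℝ) / 2 + ((l + 2 * j : ℕ) : ℝ)) = A at *
  generalize Gamma ((n : ℝ) / 2 + l + 1 / 2 + j) = B at *
  generalize (2 : ℝ) ^ ((n : ℝ) / 2) = T at *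
  generalize π ^ ((n : ℝ) / 2) = U at *
  field_simp

instance sphFinite (n : ℕ) : IsFiniteMeasure (sphMeasure n) := by
  unfold sphMeasure; infer_instance

/-- the inner product of two points on the sphere -/
def tt {n : ℕ} (ω η : Sph n) : ℝ := inner ℝ (ω : EE n) (η : EE n)

lemma tt_continuous {n : ℕ} : Continuous (fun p : Sph n × Sph n => tt p.1 p.2) := by
  unfold tt; fun_prop

lemma tt_comm {n : ℕ} (ω η : Sph n) : tt ω η = tt η ω := real_inner_comm _ _

lemma tt_abs {n : ℕ} (ω η : Sph n) : |tt ω η| ≤ 1 := by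
  have := abs_real_inner_le_norm (ω : EE n) (η : EE n)
  simpa [tt] using this

lemma tt_le {n : ℕ} (ω η : Sph n) : tt ω η ≤ 1 := (le_abs_self _).trans (tt_abs ω η)

lemma pev_linP {n : ℕ} (ω η : Sph n) : pev (linP (fun i => (ω : EE n) i)) (η : EE n) = tt ω η := by
  simp only [pev, linP, tt, PiLp.inner_apply]
  simp [mul_comm]

lemma norm_sub_tt {n : ℕ} (ω η : Sph n) : ‖(ω : EE n) - (η : EE n)‖ ^ 2 = 2 - 2 * tt ω η := by
  rw [norm_sub_sq_real]
  simp [tt]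
  ring

def KK (n : ℕ) : ℝ := 2 ^ ((n : ℝ) / 2) * π ^ ((n : ℝ) / 2) / Gamma ((n : ℝ) / 2)

lemma one_sub_pos {n : ℕ} {r : ℝ} (h0 : 0 < r) (h1 : r < 1) (ω η : Sph n) : 0 < 1 - r * tt ω η := by
  have := tt_le ω η
  nlinarith

lemma ker_continuous {n : ℕ} {r : ℝ} (h0 : 0 < r) (h1 : r < 1) (s : ℝ) :
    Continuous (fun p : Sph n × Sph n => (1 - r * tt p.1 p.2) ^ s) := by
  have := tt_continuous (n := n)
  exact Continuous.rpow_const (by fun_prop) (fun p => Or.inl (one_sub_pos h0 h1 _ _).ne')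

lemma kernel_integral {n l : ℕ} (hn : 1 ≤ n) {P : MvPolynomial (Fin (n + 1)) ℝ}
    (hP : P.IsHomogeneous l) (hl : lapP P = 0) {r : ℝ} (h0 : 0 < r) (h1 : r < 1) (ω : Sph n) :
    ∫ η : Sph n, pev P η * (1 - r * tt ω η) ^ (-((n : ℝ) / 2)) ∂(sphMeasure n)
      = KK n * FF ((n : ℝ) / 2) l r * pev P ω := by
  have hν : (0 : ℝ) < (n : ℝ) / 2 := by
    have : (1 : ℝ) ≤ n := by exact_mod_cast hn
    positivity
  set ν : ℝ := (n : ℝ) / 2 with hνd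
  have hwc : Continuous (fun η : Sph n => tt ω η) := by unfold tt; fun_prop
  have hpc : Continuous (fun η : Sph n => pev P η) := (pev_continuous P).comp continuous_subtype_val
  have hsum : ∀ η : Sph n, HasSum (fun k => bb ν k * r ^ k * (pev P η * tt ω η ^ k))
      (pev P η * (1 - r * tt ω η) ^ (-ν)) := by
    intro η
    have hx : |r * tt ω η| < 1 := by
      rw [abs_mul, abs_of_pos h0]
      have := tt_abs ω η
      nlinarith [abs_nonneg (tt ω η)]
    refine ((bb_hasSum hν hx).mul_left (pev P η)).congr_fun ?_
    intro k
    rw [mul_pow]; ring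
  have hI := hasSum_integral_of_summable_integral_norm (μ := sphMeasure n)
    (F := fun k (η : Sph n) => bb ν k * r ^ k * (pev P η * tt ω η ^ k))
    (fun k => sph_integrable (by fun_prop))
    (by
      have hr : Summable (fun k => bb ν k * r ^ k) :=
        (bb_hasSum hν (x := r) (by rw [abs_of_pos h0]; exact h1)).summable
      refine Summable.of_nonneg_of_le (fun k => integral_nonneg fun _ => norm_nonneg _) (fun k => ?_)
        (hr.mul_right (∫ η : Sph n, ‖pev P η‖ ∂(sphMeasure n)))
      rw [← integral_const_mul]
      refine integral_mono (sph_integrable (by fun_prop)) (sph_integrable (by fun_prop)) fun η => ?_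
      have hb := mul_nonneg (bb_nonneg hν k) (pow_nonneg h0.le k)
      simp only [norm_mul, norm_of_nonneg hb, norm_pow]
      refine mul_le_mul_of_nonneg_left ?_ hb
      refine mul_le_of_le_one_right (norm_nonneg _) (pow_le_one₀ (norm_nonneg _) (tt_abs ω η)))
  have e1 : ∀ η : Sph n, ∑' k, bb ν k * r ^ k * (pev P η * tt ω η ^ k)
      = pev P η * (1 - r * tt ω η) ^ (-ν) := fun η => (hsum η).tsum_eq
  simp only [e1] at hI
  have e2 : ∀ k, ∫ η : Sph n, bb ν k * r ^ k * (pev P η * tt ω η ^ k) ∂(sphMeasure n)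
      = bb ν k * r ^ k * sint (P * linP (fun i => (ω : EE n) i) ^ k) := by
    intro k
    rw [integral_const_mul]
    congr 1
    unfold sint
    congr 1
    funext η
    rw [← pev_linP]
    simp [pev]
  simp only [e2] at hI
  have hw : ∑ i, (ω : EE n) i ^ 2 = 1 := by
    have := EuclideanSpace.real_norm_sq_eq (ω : EE n)
    rw [← this]; simp
  have hinj : Function.Injective (fun j : ℕ => l + 2 * j) := by
    intro a b h
    simp only at h
    omega
  rw [← hinj.hasSum_iff] at hI
  · rw [← hI.tsum_eq]
    have e3 : ∀ j, ((fun k => bb ν k * r ^ k * sint (P * linP (fun i => (ω : EE n) i) ^ k)) ∘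
        (fun j : ℕ => l + 2 * j)) j = (KK n * r ^ l * pev P ω) * (cc (ν + l) j * (r ^ 2) ^ j) := by
      intro j
      simp only [Function.comp]
      rw [((moment hn (ω : EE n) hw (l + 2 * j)) l P hP hl).1 j rfl]
      have := mc_bb hn l j
      rw [← hνd] at this
      rw [pow_add, pow_mul]
      unfold KK
      rw [← hνd]
      linear_combination (r ^ l * (r ^ 2) ^ j * pev P (ω : EE n)) * this
    rw [tsum_congr e3, tsum_mul_left]
    unfold FF
    ring
  · intro k hk
    rw [((moment hn (ω : EE n) hw k) l P hP hl).2, mul_zero]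
    intro j hj
    exact hk ⟨j, hj.symm⟩

lemma double_reg {n l : ℕ} (hn : 1 ≤ n) {P : MvPolynomial (Fin (n + 1)) ℝ}
    (hP : P.IsHomogeneous l) (hl : lapP P = 0)
    (hnorm : ∫ ω : Sph n, (pev P ω) ^ 2 ∂(sphMeasure n) = 1)
    {r : ℝ} (h0 : 0 < r) (h1 : r < 1) :
    ∫ p : Sph n × Sph n, (pev P p.1 - pev P p.2) ^ 2 * (1 - r * tt p.1 p.2) ^ (-((n : ℝ) / 2))
      ∂((sphMeasure n).prod (sphMeasure n))
      = 2 * KK n * (FF ((n : ℝ) / 2) 0 r - FF ((n : ℝ) / 2) l r) := by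
  have hker := ker_continuous (n := n) h0 h1 (-((n : ℝ) / 2))
  have hpc : Continuous (fun η : Sph n => pev P η) := (pev_continuous P).comp continuous_subtype_val
  have hpc1 : Continuous (fun p : Sph n × Sph n => pev P p.1) := hpc.comp continuous_fst
  have hpc2 : Continuous (fun p : Sph n × Sph n => pev P p.2) := hpc.comp continuous_snd
  have hcint : ∀ f : Sph n × Sph n → ℝ, Continuous f →
      Integrable f ((sphMeasure n).prod (sphMeasure n)) := fun f hf =>
    hf.integrable_of_hasCompactSupport (HasCompactSupport.of_compactSpace f)
  have hone : ∀ ω : Sph n, ∫ η : Sph n, (1 - r * tt ω η) ^ (-((n : ℝ) / 2)) ∂(sphMeasure n)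
      = KK n * FF ((n : ℝ) / 2) 0 r := by
    intro ω
    have := kernel_integral hn (P := 1) (MvPolynomial.isHomogeneous_one _ _)
      (by simp [lapP]) h0 h1 ω
    simpa [pev] using this
  have hY := kernel_integral hn hP hl h0 h1
  have a1 : ∫ p : Sph n × Sph n, pev P p.1 ^ 2 * (1 - r * tt p.1 p.2) ^ (-((n : ℝ) / 2))
      ∂((sphMeasure n).prod (sphMeasure n)) = KK n * FF ((n : ℝ) / 2) 0 r := by
    rw [integral_prod _ (hcint _ (by fun_prop))]
    simp only [integral_const_mul, hone, integral_mul_const, hnorm, one_mul]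
  have a2 : ∫ p : Sph n × Sph n, pev P p.2 ^ 2 * (1 - r * tt p.1 p.2) ^ (-((n : ℝ) / 2))
      ∂((sphMeasure n).prod (sphMeasure n)) = KK n * FF ((n : ℝ) / 2) 0 r := by
    rw [← a1, ← integral_prod_swap]
    simp only [Prod.fst_swap, Prod.snd_swap]
    congr 1
    funext p
    rw [tt_comm]
  have a3 : ∫ p : Sph n × Sph n, pev P p.1 * (pev P p.2 * (1 - r * tt p.1 p.2) ^ (-((n : ℝ) / 2)))
      ∂((sphMeasure n).prod (sphMeasure n)) = KK n * FF ((n : ℝ) / 2) l r := by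
    rw [integral_prod _ (hcint _ (by fun_prop))]
    simp only [integral_const_mul, hY]
    have : ∀ ω : Sph n, pev P ω * (KK n * FF ((n : ℝ) / 2) l r * pev P ω)
      = KK n * FF ((n : ℝ) / 2) l r * pev P ω ^ 2 := fun ω => by ring
    simp only [this, integral_const_mul, hnorm, mul_one]
  have e : ∀ p : Sph n × Sph n, (pev P p.1 - pev P p.2) ^ 2 * (1 - r * tt p.1 p.2) ^ (-((n : ℝ) / 2))
      = (pev P p.1 ^ 2 * (1 - r * tt p.1 p.2) ^ (-((n : ℝ) / 2))
        + pev P p.2 ^ 2 * (1 - r * tt p.1 p.2) ^ (-((n : ℝ) / 2)))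
        - 2 * (pev P p.1 * (pev P p.2 * (1 - r * tt p.1 p.2) ^ (-((n : ℝ) / 2)))) := fun p => by ring
  simp only [e]
  rw [integral_sub, integral_add, integral_const_mul, a1, a2, a3]
  · ring
  all_goals exact hcint _ (by fun_prop)

/-- approximating radii -/
def rr (m : ℕ) : ℝ := 1 - 1 / ((m : ℝ) + 2)

lemma rr_pos (m : ℕ) : 0 < rr m := by
  unfold rr
  have : (0 : ℝ) ≤ m := by positivity
  rw [sub_pos, div_lt_one (by positivity)]
  linarith

lemma rr_lt (m : ℕ) : rr m < 1 := by
  unfold rr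
  have : (0 : ℝ) < 1 / ((m : ℝ) + 2) := by positivity
  linarith

lemma rr_mono {a b : ℕ} (h : a ≤ b) : rr a ≤ rr b := by
  unfold rr
  have : (a : ℝ) ≤ b := by exact_mod_cast h
  have : 1 / ((b : ℝ) + 2) ≤ 1 / ((a : ℝ) + 2) := by gcongr
  linarith

lemma rr_tendsto : Filter.Tendsto rr Filter.atTop (nhdsWithin 1 (Set.Iio 1)) := by
  refine tendsto_nhdsWithin_iff.2 ⟨?_, .of_forall rr_lt⟩
  have h := (tendsto_one_div_add_atTop_nhds_zero_nat (𝕜 := ℝ)).comp (Filter.tendsto_add_atTop_nat 1)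
  have h2 := h.const_sub 1
  rw [sub_zero] at h2
  refine h2.congr fun m => ?_
  simp [rr]
  ring

lemma main_aux {n l : ℕ} (hn : 1 ≤ n) {P : MvPolynomial (Fin (n + 1)) ℝ}
    (hP : P.IsHomogeneous l) (hl : lapP P = 0)
    (hnorm : ∫ ω : Sph n, (pev P ω) ^ 2 ∂(sphMeasure n) = 1) :
    ∫ ω : Sph n, ∫ η : Sph n, (pev P ω - pev P η) ^ 2 / ‖(ω : EE n) - (η : EE n)‖ ^ n
        ∂(sphMeasure n) ∂(sphMeasure n)
      = 2 ^ (-((n : ℝ) / 2)) * (2 * KK n * ∑ k ∈ Finset.range l, 2 / ((n : ℝ) / 2 + k)) := by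
  have hν : (0 : ℝ) < (n : ℝ) / 2 := by
    have : (1 : ℝ) ≤ n := by exact_mod_cast hn
    positivity
  set ν : ℝ := (n : ℝ) / 2 with hνd
  set S : ℝ := 2 ^ (-ν) * (2 * KK n * ∑ k ∈ Finset.range l, 2 / (ν + k)) with hS
  set μ := (sphMeasure n).prod (sphMeasure n) with hμ
  set G : ℕ → Sph n × Sph n → ℝ := fun m p =>
    2 ^ (-ν) * (rr m ^ ν * ((pev P p.1 - pev P p.2) ^ 2 * (1 - rr m * tt p.1 p.2) ^ (-ν))) with hG
  set F : Sph n × Sph n → ℝ := fun p =>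
    (pev P p.1 - pev P p.2) ^ 2 / ‖(p.1 : EE n) - (p.2 : EE n)‖ ^ n with hF
  have hpc : Continuous (fun η : Sph n => pev P η) := (pev_continuous P).comp continuous_subtype_val
  have hpc1 : Continuous (fun p : Sph n × Sph n => pev P p.1) := hpc.comp continuous_fst
  have hpc2 : Continuous (fun p : Sph n × Sph n => pev P p.2) := hpc.comp continuous_snd
  have hGc : ∀ m, Continuous (G m) := by
    intro m
    have := ker_continuous (n := n) (rr_pos m) (rr_lt m) (-ν)
    fun_prop
  have hGi : ∀ m, Integrable (G m) μ := fun m =>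
    (hGc m).integrable_of_hasCompactSupport (HasCompactSupport.of_compactSpace _)
  have hG0 : ∀ m p, 0 ≤ G m p := by
    intro m p
    have h1 := (one_sub_pos (rr_pos m) (rr_lt m) p.1 p.2).le
    have h2 := (rr_pos m).le
    simp only [hG]
    positivity
  have hGalt : ∀ m p, G m p = 2 ^ (-ν) * ((pev P p.1 - pev P p.2) ^ 2 * ((rr m)⁻¹ - tt p.1 p.2) ^ (-ν)) := by
    intro m p
    have h2 := rr_pos m
    have h1 := one_sub_pos (rr_pos m) (rr_lt m) p.1 p.2
    have : (rr m)⁻¹ - tt p.1 p.2 = (rr m)⁻¹ * (1 - rr m * tt p.1 p.2) := by field_simp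
    rw [this, mul_rpow (inv_nonneg.2 h2.le) h1.le, inv_rpow h2.le, rpow_neg h2.le, inv_inv]
    simp only [hG]
    ring
  have hmono : ∀ p, Monotone (fun m => G m p) := by
    intro p a b hab
    simp only [hGalt]
    have h1 : (rr b)⁻¹ ≤ (rr a)⁻¹ := inv_anti₀ (rr_pos a) (rr_mono hab)
    have h2 : 1 < (rr b)⁻¹ := (one_lt_inv₀ (rr_pos b)).2 (rr_lt b)
    have h3 := tt_le p.1 p.2
    have h4 := rpow_le_rpow_of_nonpos (z := -ν) (show 0 < (rr b)⁻¹ - tt p.1 p.2 by linarith)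
      (show (rr b)⁻¹ - tt p.1 p.2 ≤ (rr a)⁻¹ - tt p.1 p.2 by linarith) (by linarith)
    gcongr
  have hlim : ∀ p, Filter.Tendsto (fun m => G m p) Filter.atTop (nhds (F p)) := by
    intro p
    by_cases hp : p.1 = p.2
    · have e : ∀ m, G m p = 0 := fun m => by simp [hG, hp]
      have e' : F p = 0 := by simp [hF, hp]
      simp [e, e']
    · have hd : 0 < ‖(p.1 : EE n) - (p.2 : EE n)‖ := by
        rw [norm_pos_iff, sub_ne_zero]
        exact fun h => hp (Subtype.ext h)
      have hq := norm_sub_tt p.1 p.2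
      have ht : 0 < 1 - tt p.1 p.2 := by nlinarith
      have hFe : F p = 2 ^ (-ν) * ((1 : ℝ) ^ ν * ((pev P p.1 - pev P p.2) ^ 2 * (1 - 1 * tt p.1 p.2) ^ (-ν))) := by
        have : ‖(p.1 : EE n) - (p.2 : EE n)‖ ^ n = 2 ^ ν * (1 - tt p.1 p.2) ^ ν := by
          rw [← mul_rpow (by norm_num) ht.le, show 2 * (1 - tt p.1 p.2) = 2 - 2 * tt p.1 p.2 by ring, ← hq,
            ← rpow_natCast _ 2, ← rpow_mul hd.le, hνd, ← rpow_natCast]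
          congr 1
          push_cast
          ring
        simp only [hF]
        rw [this, rpow_neg (by norm_num), one_mul, rpow_neg ht.le, one_rpow]
        field_simp
      rw [hFe]
      have hc : ContinuousAt (fun r : ℝ => 2 ^ (-ν) * (r ^ ν * ((pev P p.1 - pev P p.2) ^ 2 * (1 - r * tt p.1 p.2) ^ (-ν)))) 1 := by
        refine continuousAt_const.mul (ContinuousAt.mul ?_ (continuousAt_const.mul ?_))
        · exact continuousAt_id.rpow_const (Or.inl one_ne_zero)
        · exact ContinuousAt.rpow_const (by fun_prop) (Or.inl (by linarith))
      exact hc.tendsto.comp (rr_tendsto.mono_right nhdsWithin_le_nhds)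
  have hF0 : ∀ p, 0 ≤ F p := fun p => by simp only [hF]; positivity
  have hFm : Measurable F := measurable_of_tendsto_metrizable (fun m => (hGc m).measurable)
    (tendsto_pi_nhds.2 hlim)
  have hintG : ∀ m, ∫ p, G m p ∂μ = 2 ^ (-ν) * (rr m ^ ν * (2 * KK n * (FF ν 0 (rr m) - FF ν l (rr m)))) := by
    intro m
    simp only [hG, integral_const_mul]
    rw [double_reg hn hP hl hnorm (rr_pos m) (rr_lt m)]
  have hintlim : Filter.Tendsto (fun m => ∫ p, G m p ∂μ) Filter.atTop (nhds S) := by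
    simp only [hintG]
    have h1 := (FF_tendsto hν l).comp rr_tendsto
    have h2 : Filter.Tendsto (fun m => rr m ^ ν) Filter.atTop (nhds 1) := by
      have hc : ContinuousAt (fun r : ℝ => r ^ ν) 1 := continuousAt_id.rpow_const (Or.inl one_ne_zero)
      have := hc.tendsto.comp (rr_tendsto.mono_right nhdsWithin_le_nhds)
      simpa [Function.comp_def] using this
    have h3 := (h2.mul (h1.const_mul (2 * KK n))).const_mul (2 ^ (-ν))
    rw [one_mul] at h3
    exact h3
  have hlint : Filter.Tendsto (fun m => ∫⁻ p, ENNReal.ofReal (G m p) ∂μ) Filter.atTop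
      (nhds (∫⁻ p, ENNReal.ofReal (F p) ∂μ)) := by
    refine lintegral_tendsto_of_tendsto_of_monotone
      (fun m => (hGc m).measurable.ennreal_ofReal.aemeasurable)
      (.of_forall fun p a b hab => ENNReal.ofReal_le_ofReal (hmono p hab))
      (.of_forall fun p => (ENNReal.continuous_ofReal.tendsto _).comp (hlim p))
  have hlint2 : ∫⁻ p, ENNReal.ofReal (F p) ∂μ = ENNReal.ofReal S := by
    refine tendsto_nhds_unique hlint ?_
    refine ((ENNReal.continuous_ofReal.tendsto _).comp hintlim).congr fun m => ?_
    exact ofReal_integral_eq_lintegral_ofReal (hGi m) (.of_forall (hG0 m))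
  have hS0 : 0 ≤ S := ge_of_tendsto' hintlim fun m => integral_nonneg (hG0 m)
  have hFi : Integrable F μ := by
    refine ⟨hFm.aestronglyMeasurable, ?_⟩
    rw [hasFiniteIntegral_iff_ofReal (.of_forall hF0), hlint2]
    exact ENNReal.ofReal_lt_top
  have hfin : ∫ p, F p ∂μ = S := by
    rw [integral_eq_lintegral_of_nonneg_ae (.of_forall hF0) hFm.aestronglyMeasurable, hlint2,
      ENNReal.toReal_ofReal hS0]
  rw [← hfin, hμ, integral_prod _ hFi]


/-- for an `L²`-normalized spherical harmonic `Y` of degree `l ≥ 1` on `S^n`,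
`∬_{S^n×S^n} |Y(ω)−Y(η)|²/|ω−η|^n dωdη = (4π^{n/2}/Γ(n/2))·(ψ(n/2+l) − ψ(n/2))`. -/
theorem double_integral_spherical_harmonic (n l : ℕ) (hn : 1 ≤ n) (hl : 1 ≤ l)
    (Y : Sph n → ℝ) (hY : IsSphericalHarmonic l Y)
    (hnorm : ∫ ω : Sph n, (Y ω) ^ 2 ∂(sphMeasure n) = 1) :
    ∫ ω : Sph n, ∫ η : Sph n,
        (Y ω - Y η) ^ 2
          / ‖(ω : EuclideanSpace ℝ (Fin (n + 1))) - (η : EuclideanSpace ℝ (Fin (n + 1)))‖ ^ n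
        ∂(sphMeasure n) ∂(sphMeasure n)
      = (4 * π ^ ((n : ℝ) / 2) / Real.Gamma ((n : ℝ) / 2))
          * (digamma ((n : ℝ) / 2 + (l : ℝ)) - digamma ((n : ℝ) / 2)) := by
  obtain ⟨P, hP, hlap, hYP⟩ := hY
  have hYP' : ∀ ω : Sph n, Y ω = pev P ω := hYP
  simp only [hYP'] at hnorm ⊢
  have hν : (0 : ℝ) < (n : ℝ) / 2 := by
    have : (1 : ℝ) ≤ n := by exact_mod_cast hn
    positivity
  have h := main_aux hn hP hlap hnorm
  rw [h, digamma_sum hν l, KK, rpow_neg (by norm_num)]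
  have h2 : (2 : ℝ) ^ ((n : ℝ) / 2) ≠ 0 := by positivity
  have e : ∑ k ∈ Finset.range l, 2 / ((n : ℝ) / 2 + k) =
      2 * ∑ k ∈ Finset.range l, 1 / ((n : ℝ) / 2 + k) := by
    rw [Finset.mul_sum]
    refine Finset.sum_congr rfl fun k _ => by ring
  rw [e]
  field_simp
  ring
end
end
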